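/- Let W be a random variable with E[W] = 0 and E[W²] = 2b² ∈ (0,∞), let W^L (defined on the same probability space) have the centered equilibrium distribution with respect to W, and let Z ~ Laplace(0,b). Then for every β > 0, d_K(W^L, Z) ≤ β/b + 2·P(|W − W^L| > β). -/

import Mathlib

open MeasureTheory ProbabilityTheory Real Set

/-- The Laplace(0,b) distribution on ℝ, with density (1/(2b))·exp(−|x|/b). -/
noncomputable def laplaceDist (b : ℝ) : Measure ℝ :=
  (volume : Measure ℝ).withDensity fun x => ENNReal.ofReal (Real.exp (-|x| / b) / (2 * b))

/-- Kolmogorov distance between two laws on ℝ. -/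
noncomputable def kolDist (μ ν : Measure ℝ) : ℝ :=
  ⨆ z : ℝ, |(μ (Iic z)).toReal - (ν (Iic z)).toReal|

/-- Wasserstein distance between two laws on ℝ: sup over 1-Lipschitz test functions. -/
noncomputable def wassDist (μ ν : Measure ℝ) : ℝ :=
  ⨆ h : {h : ℝ → ℝ // LipschitzWith 1 h}, |(∫ x, h.1 x ∂μ) - ∫ x, h.1 x ∂ν|

/-- d₂ distance: sup over differentiable h with 1-Lipschitz derivative. -/
noncomputable def d2Dist (μ ν : Measure ℝ) : ℝ :=
  ⨆ h : {h : ℝ → ℝ // Differentiable ℝ h ∧ LipschitzWith 1 (deriv h)},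
    |(∫ x, h.1 x ∂μ) - ∫ x, h.1 x ∂ν|

/-- d₁,₂ distance: sup over differentiable h with ‖h'‖∞ ≤ 1 and 1-Lipschitz derivative. -/
noncomputable def d12Dist (μ ν : Measure ℝ) : ℝ :=
  ⨆ h : {h : ℝ → ℝ //
      Differentiable ℝ h ∧ (∀ x, |deriv h x| ≤ 1) ∧ LipschitzWith 1 (deriv h)},
    |(∫ x, h.1 x ∂μ) - ∫ x, h.1 x ∂ν|

/-- The Beta(1,m) distribution on ℝ, with density m(1−x)^{m−1} on (0,1). -/
noncomputable def betaOneDist (m : ℕ) : Measure ℝ :=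
  (volume : Measure ℝ).withDensity fun x =>
    ENNReal.ofReal (if 0 < x ∧ x < 1 then m * (1 - x) ^ (m - 1) else 0)

/-- `WL` has the centered equilibrium distribution with respect to `W`:
`E[f(W)] − f(0) = (1/2)·E[W²]·E[f''(WL)]` for all twice differentiable `f` such that
`E|f(W)| < ∞` and `E|W f'(W)| < ∞` (and `f''(WL)` is integrable). -/
def IsCenteredEquilibrium {Ω : Type*} [MeasureSpace Ω] (W WL : Ω → ℝ) : Prop :=
  ∀ f : ℝ → ℝ, Differentiable ℝ f → Differentiable ℝ (deriv f) →
    Integrable (fun ω => f (W ω)) → Integrable (fun ω => W ω * deriv f (W ω)) →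
    Integrable (fun ω => deriv (deriv f) (WL ω)) →
    (∫ ω, f (W ω)) - f 0 = (1 / 2) * (∫ ω, (W ω) ^ 2) * ∫ ω, deriv (deriv f) (WL ω)

/-- Exponentially weighted lower integral of `h`. -/
noncomputable def lowerExpIntegral (a : ℝ) (h : ℝ → ℝ) (x : ℝ) : ℝ :=
  ∫ y in Iic x, exp (a * y) * h y

/-- Exponentially weighted upper integral of `h`. -/
noncomputable def upperExpIntegral (a : ℝ) (h : ℝ → ℝ) (x : ℝ) : ℝ :=
  ∫ y in Ioi x, exp (-a * y) * h y

/-- The convolution of `h` with the Laplace density of rate `a`, which is the bounded solution `g` of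
the equation expressing `h` as `g` minus `a⁻²` times the second derivative of `g`. -/
noncomputable def laplaceConv (a : ℝ) (h : ℝ → ℝ) (x : ℝ) : ℝ :=
  a / 2 * (exp (-a * x) * lowerExpIntegral a h x + exp (a * x) * upperExpIntegral a h x)

/-- The derivative of `laplaceConv a h`. -/
noncomputable def laplaceConvDeriv (a : ℝ) (h : ℝ → ℝ) (x : ℝ) : ℝ :=
  a ^ 2 / 2 * (exp (a * x) * upperExpIntegral a h x - exp (-a * x) * lowerExpIntegral a h x)

section LaplaceConv

variable {a : ℝ} {h : ℝ → ℝ}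

lemma integrableOn_exp_mul_Iic_of_mem_Icc (ha : 0 < a) (hc : Continuous h)
    (h01 : ∀ x, h x ∈ Icc (0 : ℝ) 1) (x : ℝ) :
    IntegrableOn (fun y => exp (a * y) * h y) (Iic x) := by
  refine (integrableOn_exp_mul_Iic ha x).mono' (by fun_prop) (ae_of_all _ fun y => ?_)
  rw [norm_mul, Real.norm_eq_abs, Real.norm_eq_abs, abs_of_pos (exp_pos _),
    abs_of_nonneg (h01 y).1]
  exact mul_le_of_le_one_right (exp_pos _).le (h01 y).2

lemma integrableOn_exp_mul_Ioi_of_mem_Icc (ha : 0 < a) (hc : Continuous h)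
    (h01 : ∀ x, h x ∈ Icc (0 : ℝ) 1) (x : ℝ) :
    IntegrableOn (fun y => exp (-a * y) * h y) (Ioi x) := by
  refine (integrableOn_exp_mul_Ioi (neg_lt_zero.2 ha) x).mono' (by fun_prop)
    (ae_of_all _ fun y => ?_)
  rw [norm_mul, Real.norm_eq_abs, Real.norm_eq_abs, abs_of_pos (exp_pos _),
    abs_of_nonneg (h01 y).1]
  exact mul_le_of_le_one_right (exp_pos _).le (h01 y).2

lemma exp_mul_lowerExpIntegral_mem_Icc (ha : 0 < a) (hc : Continuous h)
    (h01 : ∀ x, h x ∈ Icc (0 : ℝ) 1) (x : ℝ) :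
    exp (-a * x) * lowerExpIntegral a h x ∈ Icc 0 (1 / a) := by
  have hle : lowerExpIntegral a h x ≤ exp (a * x) / a := by
    rw [← integral_exp_mul_Iic ha x]
    exact integral_mono (integrableOn_exp_mul_Iic_of_mem_Icc ha hc h01 x)
      (integrableOn_exp_mul_Iic ha x)
      fun y => mul_le_of_le_one_right (exp_pos _).le (h01 y).2
  refine ⟨mul_nonneg (exp_pos _).le
    (integral_nonneg fun y => mul_nonneg (exp_pos _).le (h01 y).1), ?_⟩
  calc exp (-a * x) * lowerExpIntegral a h x
      ≤ exp (-a * x) * (exp (a * x) / a) := by gcongr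
    _ = 1 / a := by rw [← mul_div_assoc, ← exp_add]; simp

lemma exp_mul_upperExpIntegral_mem_Icc (ha : 0 < a) (hc : Continuous h)
    (h01 : ∀ x, h x ∈ Icc (0 : ℝ) 1) (x : ℝ) :
    exp (a * x) * upperExpIntegral a h x ∈ Icc 0 (1 / a) := by
  have hle : upperExpIntegral a h x ≤ exp (-a * x) / a := by
    have := integral_exp_mul_Ioi (neg_lt_zero.2 ha) x
    rw [neg_div_neg_eq] at this
    rw [← this]
    exact integral_mono (integrableOn_exp_mul_Ioi_of_mem_Icc ha hc h01 x)
      (integrableOn_exp_mul_Ioi (neg_lt_zero.2 ha) x)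
      fun y => mul_le_of_le_one_right (exp_pos _).le (h01 y).2
  refine ⟨mul_nonneg (exp_pos _).le
    (integral_nonneg fun y => mul_nonneg (exp_pos _).le (h01 y).1), ?_⟩
  calc exp (a * x) * upperExpIntegral a h x
      ≤ exp (a * x) * (exp (-a * x) / a) := by gcongr
    _ = 1 / a := by rw [← mul_div_assoc, ← exp_add]; simp

lemma laplaceConv_mem_Icc (ha : 0 < a) (hc : Continuous h)
    (h01 : ∀ x, h x ∈ Icc (0 : ℝ) 1) (x : ℝ) : laplaceConv a h x ∈ Icc (0 : ℝ) 1 := by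
  obtain ⟨hl, hl'⟩ := exp_mul_lowerExpIntegral_mem_Icc ha hc h01 x
  obtain ⟨hu, hu'⟩ := exp_mul_upperExpIntegral_mem_Icc ha hc h01 x
  refine ⟨mul_nonneg (by positivity) (add_nonneg hl hu), ?_⟩
  calc laplaceConv a h x ≤ a / 2 * (1 / a + 1 / a) := by unfold laplaceConv; gcongr
    _ = 1 := by field_simp; norm_num

lemma abs_laplaceConvDeriv_le (ha : 0 < a) (hc : Continuous h)
    (h01 : ∀ x, h x ∈ Icc (0 : ℝ) 1) (x : ℝ) : |laplaceConvDeriv a h x| ≤ a / 2 := by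
  obtain ⟨hl, hl'⟩ := exp_mul_lowerExpIntegral_mem_Icc ha hc h01 x
  obtain ⟨hu, hu'⟩ := exp_mul_upperExpIntegral_mem_Icc ha hc h01 x
  rw [laplaceConvDeriv, abs_mul, abs_of_pos (by positivity)]
  calc _ ≤ a ^ 2 / 2 * (1 / a) := by
        gcongr
        rw [abs_le]
        constructor <;> linarith
    _ = a / 2 := by field_simp

lemma hasDerivAt_lowerExpIntegral (ha : 0 < a) (hc : Continuous h)
    (h01 : ∀ x, h x ∈ Icc (0 : ℝ) 1) (x : ℝ) :
    HasDerivAt (lowerExpIntegral a h) (exp (a * x) * h x) x := by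
  have hi := integrableOn_exp_mul_Iic_of_mem_Icc ha hc h01
  have heq : lowerExpIntegral a h =
      fun x => lowerExpIntegral a h 0 + ∫ y in (0 : ℝ)..x, exp (a * y) * h y := by
    funext x
    rw [← intervalIntegral.integral_Iic_sub_Iic (hi 0) (hi x)]
    simp [lowerExpIntegral]
  have hcont : Continuous fun y => exp (a * y) * h y := by fun_prop
  rw [heq]
  exact (hcont.integral_hasStrictDerivAt 0 x).hasDerivAt.const_add _

lemma hasDerivAt_upperExpIntegral (ha : 0 < a) (hc : Continuous h)
    (h01 : ∀ x, h x ∈ Icc (0 : ℝ) 1) (x : ℝ) :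
    HasDerivAt (upperExpIntegral a h) (-(exp (-a * x) * h x)) x := by
  have hi := integrableOn_exp_mul_Ioi_of_mem_Icc ha hc h01
  have heq : upperExpIntegral a h =
      fun x => upperExpIntegral a h 0 - ∫ y in (0 : ℝ)..x, exp (-a * y) * h y := by
    funext x
    have := intervalIntegral.integral_interval_add_Ioi (hi 0) (hi x)
    simp only [upperExpIntegral]
    linarith
  have hcont : Continuous fun y => exp (-a * y) * h y := by fun_prop
  rw [heq]
  exact (hcont.integral_hasStrictDerivAt 0 x).hasDerivAt.const_sub _

lemma hasDerivAt_exp_const_mul (c x : ℝ) :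
    HasDerivAt (fun x => exp (c * x)) (exp (c * x) * c) x := by
  simpa using ((hasDerivAt_id x).const_mul c).exp

lemma hasDerivAt_laplaceConv (ha : 0 < a) (hc : Continuous h)
    (h01 : ∀ x, h x ∈ Icc (0 : ℝ) 1) (x : ℝ) :
    HasDerivAt (laplaceConv a h) (laplaceConvDeriv a h x) x := by
  have hl := (hasDerivAt_exp_const_mul (-a) x).mul (hasDerivAt_lowerExpIntegral ha hc h01 x)
  have hu := (hasDerivAt_exp_const_mul a x).mul (hasDerivAt_upperExpIntegral ha hc h01 x)
  refine ((hl.add hu).const_mul (a / 2)).congr_deriv ?_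
  rw [laplaceConvDeriv]
  ring

lemma hasDerivAt_laplaceConvDeriv (ha : 0 < a) (hc : Continuous h)
    (h01 : ∀ x, h x ∈ Icc (0 : ℝ) 1) (x : ℝ) :
    HasDerivAt (laplaceConvDeriv a h) (a ^ 2 * (laplaceConv a h x - h x)) x := by
  have hl := (hasDerivAt_exp_const_mul (-a) x).mul (hasDerivAt_lowerExpIntegral ha hc h01 x)
  have hu := (hasDerivAt_exp_const_mul a x).mul (hasDerivAt_upperExpIntegral ha hc h01 x)
  refine ((hu.sub hl).const_mul (a ^ 2 / 2)).congr_deriv ?_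
  have hexp : exp (a * x) * exp (-a * x) = 1 := by rw [← exp_add]; simp
  rw [laplaceConv]
  linear_combination (-(a ^ 2 * h x)) * hexp

lemma continuous_laplaceConv (ha : 0 < a) (hc : Continuous h)
    (h01 : ∀ x, h x ∈ Icc (0 : ℝ) 1) : Continuous (laplaceConv a h) :=
  continuous_iff_continuousAt.2 fun x => (hasDerivAt_laplaceConv ha hc h01 x).continuousAt

lemma continuous_laplaceConvDeriv (ha : 0 < a) (hc : Continuous h)
    (h01 : ∀ x, h x ∈ Icc (0 : ℝ) 1) : Continuous (laplaceConvDeriv a h) :=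
  continuous_iff_continuousAt.2 fun x => (hasDerivAt_laplaceConvDeriv ha hc h01 x).continuousAt

lemma abs_laplaceConv_sub_le (ha : 0 < a) (hc : Continuous h)
    (h01 : ∀ x, h x ∈ Icc (0 : ℝ) 1) (x y : ℝ) :
    |laplaceConv a h y - laplaceConv a h x| ≤ a / 2 * |y - x| :=
  Convex.norm_image_sub_le_of_norm_hasDerivWithin_le
    (fun z _ => (hasDerivAt_laplaceConv ha hc h01 z).hasDerivWithinAt)
    (fun z _ => abs_laplaceConvDeriv_le ha hc h01 z) convex_univ (mem_univ x) (mem_univ y)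

lemma integral_laplaceDist {b : ℝ} (hb : 0 < b) (f : ℝ → ℝ) :
    ∫ x, f x ∂laplaceDist b = ∫ x, exp (-|x| / b) / (2 * b) * f x := by
  rw [laplaceDist, integral_withDensity_eq_integral_toReal_smul (by fun_prop) (by simp)]
  refine integral_congr_ae (ae_of_all _ fun x => ?_)
  dsimp only
  rw [ENNReal.toReal_ofReal (by positivity), smul_eq_mul]

lemma laplaceDensity_of_nonpos (b : ℝ) {x : ℝ} (hx : x ≤ 0) :
    exp (-|x| / b) / (2 * b) = b⁻¹ / 2 * exp (b⁻¹ * x) := by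
  rw [abs_of_nonpos hx, neg_neg, div_eq_inv_mul x, div_eq_inv_mul _ (2 * b), mul_inv]
  ring

lemma laplaceDensity_of_nonneg (b : ℝ) {x : ℝ} (hx : 0 ≤ x) :
    exp (-|x| / b) / (2 * b) = b⁻¹ / 2 * exp (-b⁻¹ * x) := by
  rw [abs_of_nonneg hx, div_eq_inv_mul (-x), div_eq_inv_mul _ (2 * b), mul_inv, mul_neg, neg_mul]
  ring

lemma integral_laplaceDist_eq_laplaceConv_zero {b : ℝ} (hb : 0 < b) (hc : Continuous h)
    (h01 : ∀ x, h x ∈ Icc (0 : ℝ) 1) :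
    ∫ x, h x ∂laplaceDist b = laplaceConv b⁻¹ h 0 := by
  have ha : 0 < b⁻¹ := inv_pos.2 hb
  have hl : EqOn (fun x => exp (-|x| / b) / (2 * b) * h x)
      (fun x => b⁻¹ / 2 * (exp (b⁻¹ * x) * h x)) (Iic 0) := fun x hx => by
    simp only [laplaceDensity_of_nonpos b (mem_Iic.1 hx), mul_assoc]
  have hu : EqOn (fun x => exp (-|x| / b) / (2 * b) * h x)
      (fun x => b⁻¹ / 2 * (exp (-b⁻¹ * x) * h x)) (Ioi 0) := fun x hx => by
    simp only [laplaceDensity_of_nonneg b (mem_Ioi.1 hx).le, mul_assoc]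
  rw [integral_laplaceDist hb, ← intervalIntegral.integral_Iic_add_Ioi (b := 0)
    ((integrableOn_congr_fun hl measurableSet_Iic).2
      ((integrableOn_exp_mul_Iic_of_mem_Icc ha hc h01 0).const_mul _))
    ((integrableOn_congr_fun hu measurableSet_Ioi).2
      ((integrableOn_exp_mul_Ioi_of_mem_Icc ha hc h01 0).const_mul _)),
    setIntegral_congr_fun measurableSet_Iic hl, setIntegral_congr_fun measurableSet_Ioi hu,
    integral_const_mul, integral_const_mul]
  simp [laplaceConv, lowerExpIntegral, upperExpIntegral, mul_add]

lemma isFiniteMeasure_laplaceDist {b : ℝ} (hb : 0 < b) : IsFiniteMeasure (laplaceDist b) := by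
  have ha : 0 < b⁻¹ := inv_pos.2 hb
  have hint : Integrable fun x : ℝ => exp (-|x| / b) / (2 * b) := by
    rw [← integrableOn_univ, ← Iic_union_Ioi (a := (0 : ℝ))]
    refine IntegrableOn.union ?_ ?_
    · exact (integrableOn_congr_fun (fun x hx => laplaceDensity_of_nonpos b (mem_Iic.1 hx))
        measurableSet_Iic).2 ((integrableOn_exp_mul_Iic ha 0).const_mul _)
    · exact (integrableOn_congr_fun (fun x hx => laplaceDensity_of_nonneg b (mem_Ioi.1 hx).le)
        measurableSet_Ioi).2 ((integrableOn_exp_mul_Ioi (neg_lt_zero.2 ha) 0).const_mul _)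
  exact isFiniteMeasure_withDensity_ofReal hint.2

end LaplaceConv

/-- Comparison of `WL` with the Laplace law on continuous test functions with values in `[0,1]`. -/
lemma IsCenteredEquilibrium.abs_integral_sub_laplaceDist_le
    {Ω : Type*} [MeasureSpace Ω] [IsProbabilityMeasure (volume : Measure Ω)]
    {W WL : Ω → ℝ} (hWmeas : Measurable W) (hWLmeas : Measurable WL) {b : ℝ} (hb : 0 < b)
    (hWsqInt : Integrable fun ω => (W ω) ^ 2) (hWvar : ∫ ω, (W ω) ^ 2 = 2 * b ^ 2)
    (hCE : IsCenteredEquilibrium W WL) {β : ℝ} (hβ : 0 < β) {h : ℝ → ℝ} (hc : Continuous h)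
    (h01 : ∀ x, h x ∈ Icc (0 : ℝ) 1) :
    |(∫ ω, h (WL ω)) - ∫ x, h x ∂laplaceDist b| ≤
      β / (2 * b) + volume.real {ω | β < |W ω - WL ω|} := by
  have ha : 0 < b⁻¹ := inv_pos.2 hb
  have hgc := continuous_laplaceConv ha hc h01
  have hg01 := laplaceConv_mem_Icc ha hc h01
  have hderiv : deriv (laplaceConv b⁻¹ h) = laplaceConvDeriv b⁻¹ h :=
    funext fun x => (hasDerivAt_laplaceConv ha hc h01 x).deriv
  have hderiv' : deriv (laplaceConvDeriv b⁻¹ h) =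
      fun x => b⁻¹ ^ 2 * (laplaceConv b⁻¹ h x - h x) :=
    funext fun x => (hasDerivAt_laplaceConvDeriv ha hc h01 x).deriv
  have hWint : Integrable W :=
    ((memLp_two_iff_integrable_sq hWmeas.aestronglyMeasurable).2 hWsqInt).integrable one_le_two
  have hcomp : ∀ {f : ℝ → ℝ} {X : Ω → ℝ}, Continuous f → (∀ x, f x ∈ Icc (0 : ℝ) 1) →
      Measurable X → Integrable fun ω => f (X ω) := fun hf hf01 hX =>
    .of_bound (hf.measurable.comp hX).aestronglyMeasurable 1 (ae_of_all _ fun ω => by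
      rw [Real.norm_eq_abs, abs_of_nonneg (hf01 _).1]
      exact (hf01 _).2)
  have hgW := hcomp hgc hg01 hWmeas
  have hgWL := hcomp hgc hg01 hWLmeas
  have hhWL := hcomp hc h01 hWLmeas
  have key := hCE (laplaceConv b⁻¹ h)
    (fun x => (hasDerivAt_laplaceConv ha hc h01 x).differentiableAt)
    (by rw [hderiv]; exact fun x => (hasDerivAt_laplaceConvDeriv ha hc h01 x).differentiableAt)
    hgW
    (by
      rw [hderiv]
      exact hWint.mul_bdd (c := b⁻¹ / 2)
        ((continuous_laplaceConvDeriv ha hc h01).measurable.comp hWmeas).aestronglyMeasurable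
        (ae_of_all _ fun ω => abs_laplaceConvDeriv_le ha hc h01 (W ω)))
    (by
      rw [hderiv, hderiv']
      exact (hgWL.sub hhWL).const_mul _)
  rw [hderiv, hderiv', hWvar, integral_const_mul, integral_sub hgWL hhWL,
    ← integral_laplaceDist_eq_laplaceConv_zero hb hc h01] at key
  have hdiff : (∫ ω, h (WL ω)) - ∫ x, h x ∂laplaceDist b =
      ∫ ω, (laplaceConv b⁻¹ h (WL ω) - laplaceConv b⁻¹ h (W ω)) := by
    rw [integral_sub hgWL hgW]
    have hcoef : 1 / 2 * (2 * b ^ 2) * b⁻¹ ^ 2 = 1 := by field_simp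
    rw [← mul_assoc, hcoef, one_mul] at key
    linarith
  have hS : MeasurableSet {ω | β < |W ω - WL ω|} :=
    measurableSet_lt measurable_const (hWmeas.sub hWLmeas).abs
  have hind : Integrable ({ω | β < |W ω - WL ω|}.indicator fun _ => (1 : ℝ)) :=
    (integrable_const 1).indicator hS
  rw [hdiff]
  calc |∫ ω, (laplaceConv b⁻¹ h (WL ω) - laplaceConv b⁻¹ h (W ω))|
      ≤ ∫ ω, (β / (2 * b) + {ω | β < |W ω - WL ω|}.indicator (fun _ => (1 : ℝ)) ω) := by
        rw [← Real.norm_eq_abs]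
        refine norm_integral_le_of_norm_le (by exact (integrable_const _).add hind)
          (ae_of_all _ fun ω => ?_)
        rw [Real.norm_eq_abs]
        by_cases hω : β < |W ω - WL ω|
        · rw [indicator_of_mem (show ω ∈ {ω | β < |W ω - WL ω|} from hω), abs_le]
          have h₁ := hg01 (W ω)
          have h₂ := hg01 (WL ω)
          have h₃ : 0 ≤ β / (2 * b) := by positivity
          constructor <;> linarith [h₁.1, h₁.2, h₂.1, h₂.2]
        · rw [indicator_of_notMem (show ω ∉ {ω | β < |W ω - WL ω|} from hω), add_zero]
          refine (abs_laplaceConv_sub_le ha hc h01 _ _).trans ?_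
          rw [abs_sub_comm]
          calc b⁻¹ / 2 * |W ω - WL ω| ≤ b⁻¹ / 2 * β := by gcongr; exact not_lt.1 hω
            _ = β / (2 * b) := by field_simp
    _ = β / (2 * b) + volume.real {ω | β < |W ω - WL ω|} := by
        rw [integral_add (integrable_const _) hind, integral_indicator_const _ hS]
        simp

/-- Theorem 2.4: Laplace approximation bounds via the centered equilibrium distribution. -/
theorem centered_equilibrium_kolmogorov_WL
    {Ω : Type*} [MeasureSpace Ω] [IsProbabilityMeasure (volume : Measure Ω)]
    (W WL : Ω → ℝ) (hWmeas : Measurable W) (hWLmeas : Measurable WL)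
    (b : ℝ) (hb : 0 < b)
    (hWmean : ∫ ω, W ω = 0)
    (hWsqInt : Integrable fun ω => (W ω) ^ 2)
    (hWvar : ∫ ω, (W ω) ^ 2 = 2 * b ^ 2)
    (hCE : IsCenteredEquilibrium W WL)
    (β : ℝ) (hβ : 0 < β) :
    kolDist (Measure.map WL volume) (laplaceDist b) ≤
      β / b + 2 * (volume {ω | β < |W ω - WL ω|}).toReal := by
  have := isFiniteMeasure_laplaceDist hb
  have : IsProbabilityMeasure (Measure.map WL volume) :=
    Measure.isProbabilityMeasure_map hWLmeas.aemeasurable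
  refine ciSup_le fun z => ?_
  have hpos : ∀ n : ℕ, 0 < 1 / ((n : ℝ) + 1) := fun n => Nat.one_div_pos_of_nat
  have hlim := tendsto_one_div_add_atTop_nhds_zero_nat (𝕜 := ℝ)
  have hWL := tendsto_integral_thickenedIndicator_of_isClosed (Measure.map WL volume)
    (isClosed_Iic (a := z)) hpos hlim
  have hZ := tendsto_integral_thickenedIndicator_of_isClosed (laplaceDist b)
    (isClosed_Iic (a := z)) hpos hlim
  have hbound : |(Measure.map WL volume).real (Iic z) - (laplaceDist b).real (Iic z)| ≤
      β / (2 * b) + volume.real {ω | β < |W ω - WL ω|} := by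
    refine le_of_tendsto (hWL.sub hZ).abs (Filter.Eventually.of_forall fun n => ?_)
    have hcont : Continuous fun x => (thickenedIndicator (hpos n) (Iic z) x : ℝ) := by fun_prop
    rw [integral_map hWLmeas.aemeasurable hcont.aestronglyMeasurable]
    exact hCE.abs_integral_sub_laplaceDist_le hWmeas hWLmeas hb hWsqInt hWvar hβ hcont
      fun x => ⟨NNReal.coe_nonneg _, mod_cast thickenedIndicator_le_one (hpos n) (Iic z) x⟩
  have hhalf : β / (2 * b) ≤ β / b := by gcongr; linarith
  have hnonneg : 0 ≤ volume.real {ω | β < |W ω - WL ω|} := measureReal_nonneg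
  simp only [Measure.real] at hbound hnonneg
  linarith
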